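/- Let n be even and let Q : 𝔽₂ⁿ → 𝔽₂ⁿ be a pure quadratic APN function, and let B be the number of nonzero λ ∈ 𝔽₂ⁿ for which the component Q_λ is bent. If n ≥ 4 and B = 2(2ⁿ−1)/3, then the nonlinearity of Q is N(Q) = 2^(n−1) − 2^(n/2). If n ≥ 6 and B = 2(2ⁿ−1)/3 + 4t with 1 ≤ t ≤ 4, then N(Q) = 2^(n−1) − 2^(n/2+1). -/

import Mathlib

/-- The Hamming weight of a Boolean function: the number of inputs mapped to 1. -/
def wt {α : Type*} [Fintype α] (f : α → ZMod 2) : ℕ :=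
  (Finset.univ.filter fun x => f x = 1).card

/-- The derivative of a Boolean function at `a`. -/
def Dop {α : Type*} [Add α] (a : α) (f : α → ZMod 2) : α → ZMod 2 :=
  fun x => f (x + a) + f x

/-- `degLE d f` means the algebraic degree of `f` is at most `d`:
all `(d+1)`-fold iterated derivatives vanish. -/
def degLE {α : Type*} [Add α] (d : ℕ) (f : α → ZMod 2) : Prop :=
  ∀ l : List α, l.length = d + 1 → l.foldr Dop f = fun _ => 0

/-- The component `F_λ` of a vectorial Boolean function: `x ↦ λ · F(x)` (dot product mod 2). -/
def comp {n : ℕ} (lam : Fin n → ZMod 2) (F : (Fin n → ZMod 2) → (Fin n → ZMod 2)) :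
    (Fin n → ZMod 2) → ZMod 2 :=
  fun x => ∑ i, lam i * F x i

/-- `F` is APN: for every nonzero `a` and every `b`, `F(x+a) + F(x) = b` has at most
2 solutions. -/
def IsAPN {n : ℕ} (F : (Fin n → ZMod 2) → (Fin n → ZMod 2)) : Prop :=
  ∀ a : Fin n → ZMod 2, a ≠ 0 → ∀ b : Fin n → ZMod 2,
    (Finset.univ.filter fun x => F (x + a) + F x = b).card ≤ 2

/-- A Boolean function on `n` variables is bent if all its nontrivial derivatives
are balanced. -/
def IsBent {n : ℕ} (f : (Fin n → ZMod 2) → ZMod 2) : Prop :=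
  ∀ a : Fin n → ZMod 2, a ≠ 0 → wt (Dop a f) = 2 ^ (n - 1)

/-- The Walsh transform of a Boolean function on `n` variables. -/
def walsh {n : ℕ} (f : (Fin n → ZMod 2) → ZMod 2) (a : Fin n → ZMod 2) : ℤ :=
  ∑ x : Fin n → ZMod 2, (-1 : ℤ) ^ ((f x + ∑ i, a i * x i).val)

/-- The nonlinearity of a Boolean function on `n` variables:
`2^(n-1) - (1/2) * max_a |W_f(a)|`. -/
noncomputable def nl {n : ℕ} (f : (Fin n → ZMod 2) → ZMod 2) : ℤ :=
  2 ^ (n - 1) - (Finset.univ.sup' Finset.univ_nonempty fun a => |walsh f a|) / 2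

/-- The nonlinearity of a vectorial Boolean function: the minimum of the
nonlinearities of its (nonzero) components. -/
noncomputable def nlV {n : ℕ} (hn : 0 < n)
    (Q : (Fin n → ZMod 2) → (Fin n → ZMod 2)) : ℤ :=
  (Finset.univ.filter fun lam : Fin n → ZMod 2 => lam ≠ 0).inf'
    (by
      refine ⟨fun _ => 1, ?_⟩
      simp only [Finset.mem_filter, Finset.mem_univ, true_and]
      intro hcontra
      exact one_ne_zero (congrFun hcontra ⟨0, hn⟩))
    (fun lam => nl (comp lam Q))

/-- The sign `(-1)^z` of an element `z` of `ZMod 2`. -/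
def sgn (z : ZMod 2) : ℤ := (-1) ^ z.val

theorem sgn_zero : sgn 0 = 1 := by decide

theorem sgn_add : ∀ y z : ZMod 2, sgn (y + z) = sgn y * sgn z := by decide

theorem sgn_mul_self : ∀ z : ZMod 2, sgn z * sgn z = 1 := by decide

theorem sgn_eq_neg_one_of_ne_zero : ∀ z : ZMod 2, z ≠ 0 → sgn z = -1 := by decide

theorem sgn_eq_ite : ∀ z : ZMod 2, sgn z = 1 - 2 * if z = 1 then 1 else 0 := by decide

theorem add_self_zmod_two_pi {ι : Type*} (x : ι → ZMod 2) : x + x = 0 := by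
  funext i
  exact CharTwo.add_self_eq_zero (x i)

theorem sum_sgn_eq_card_sub_wt {α : Type*} [Fintype α] (f : α → ZMod 2) :
    ∑ x, sgn (f x) = Fintype.card α - 2 * (wt f : ℤ) := by
  simp only [sgn_eq_ite, Finset.sum_sub_distrib, ← Finset.mul_sum, wt]
  simp

section Group

variable {G : Type*} [AddCommGroup G]

theorem sum_eq_zero_of_shift_neg [Fintype G] {χ : G → ℤ} (a : G) (h : ∀ x, χ (x + a) = -χ x) :
    ∑ x, χ x = 0 := by
  have h1 : ∑ x, χ (x + a) = ∑ x, χ x := Equiv.sum_comp (Equiv.addRight a) χ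
  simp only [h, Finset.sum_neg_distrib] at h1
  omega

theorem dop_add (u v : G) (f : G → ZMod 2) (x : G) :
    Dop (u + v) f x = Dop u f (x + v) + Dop v f x := by
  have : x + (u + v) = x + v + u := by abel
  simp only [Dop, this]
  linear_combination -CharTwo.add_self_eq_zero (f (x + v))

/-- The linear space of `f`: the directions in which the derivative of `f` is constant. -/
def linearSpace (f : G → ZMod 2) : AddSubgroup G where
  carrier := {u | ∀ x, Dop u f x = Dop u f 0}
  zero_mem' := fun x => by simp [Dop, CharTwo.add_self_eq_zero]
  add_mem' := fun {u v} hu hv x => by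
    rw [dop_add, dop_add, hu, hv x, hu (0 + v)]
  neg_mem' := fun {u} hu x => by
    have h1 := hu (x + -u)
    have h2 := hu (0 + -u)
    simp only [Dop, neg_add_cancel_right] at h1 h2 ⊢
    rw [add_comm, h1, ← h2, add_comm]

theorem mem_linearSpace {f : G → ZMod 2} {u : G} :
    u ∈ linearSpace f ↔ ∀ x, Dop u f x = Dop u f 0 := Iff.rfl

end Group

section Boolean

variable {n : ℕ}

theorem dop_dop_const {f : (Fin n → ZMod 2) → ZMod 2} (hf : degLE 2 f)
    (a u x y : Fin n → ZMod 2) : Dop a (Dop u f) x = Dop a (Dop u f) y := by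
  have h := congrFun (hf [x + y, a, u] rfl) y
  have hxy : y + (x + y) = x := by
    rw [add_left_comm, add_self_zmod_two_pi, add_zero]
  simp only [List.foldr] at h
  rw [Dop, hxy] at h
  exact CharTwo.add_eq_zero.mp h

theorem sum_sgn_dop_of_notMem {f : (Fin n → ZMod 2) → ZMod 2} (hf : degLE 2 f)
    {u : Fin n → ZMod 2} (hu : u ∉ linearSpace f) : ∑ x, sgn (Dop u f x) = 0 := by
  rw [mem_linearSpace] at hu
  push Not at hu
  obtain ⟨a, ha⟩ := hu
  refine sum_eq_zero_of_shift_neg a fun x => ?_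
  have h1 : Dop a (Dop u f) x = Dop a (Dop u f) 0 := dop_dop_const hf a u x 0
  have h2 : Dop a (Dop u f) x ≠ 0 := by
    rw [h1, Dop, zero_add]
    exact fun h => ha (CharTwo.add_eq_zero.mp h)
  have h3 : Dop u f (x + a) = Dop a (Dop u f) x + Dop u f x := by
    rw [Dop.eq_def a, add_assoc, CharTwo.add_self_eq_zero, add_zero]
  rw [h3, sgn_add, sgn_eq_neg_one_of_ne_zero _ h2, neg_one_mul]

theorem sum_sgn_dop_of_mem {f : (Fin n → ZMod 2) → ZMod 2}
    {u : Fin n → ZMod 2} (hu : u ∈ linearSpace f) :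
    ∑ x, sgn (Dop u f x) = 2 ^ n * sgn (Dop u f 0) := by
  simp [mem_linearSpace.mp hu]

theorem isBent_iff_linearSpace_eq_bot (hn : 0 < n) {f : (Fin n → ZMod 2) → ZMod 2}
    (hf : degLE 2 f) : IsBent f ↔ linearSpace f = ⊥ := by
  have hwt : ∀ u, wt (Dop u f) = 2 ^ (n - 1) ↔ ∑ x, sgn (Dop u f x) = 0 := fun u => by
    rw [sum_sgn_eq_card_sub_wt]
    obtain ⟨m, rfl⟩ : ∃ m, n = m + 1 := ⟨n - 1, by omega⟩
    simp only [Fintype.card_pi, ZMod.card, Finset.prod_const, Finset.card_univ, Fintype.card_fin,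
      Nat.add_sub_cancel, pow_succ]
    omega
  rw [AddSubgroup.eq_bot_iff_forall, IsBent]
  refine forall_congr' fun u => ?_
  rw [hwt]
  constructor
  · intro h hu
    by_contra h0
    have h1 := h h0
    rw [sum_sgn_dop_of_mem hu] at h1
    have h2 := sgn_mul_self (Dop u f 0)
    rcases mul_eq_zero.mp h1 with h3 | h3
    · exact pow_ne_zero n two_ne_zero h3
    · simp [h3] at h2
  · exact fun h h0 => sum_sgn_dop_of_notMem hf fun hu => h0 (h hu)

theorem sum_sgn_dot (b : Fin n → ZMod 2) :
    ∑ a : Fin n → ZMod 2, sgn (∑ i, a i * b i) = if b = 0 then 2 ^ n else 0 := by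
  split_ifs with hb
  · simp [hb, sgn_zero]
  · obtain ⟨j, hj⟩ := Function.ne_iff.mp hb
    refine sum_eq_zero_of_shift_neg (Pi.single j 1) fun a => ?_
    have : ∑ i, (a + Pi.single j 1 : Fin n → ZMod 2) i * b i = b j + ∑ i, a i * b i := by
      simp [add_mul, Finset.sum_add_distrib, Pi.single_apply, add_comm]
    rw [this, sgn_add, sgn_eq_neg_one_of_ne_zero _ hj, neg_one_mul]

theorem walsh_eq_sum_sgn (f : (Fin n → ZMod 2) → ZMod 2) (a : Fin n → ZMod 2) :
    walsh f a = ∑ x, sgn (f x + ∑ i, a i * x i) := rfl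

theorem exists_walsh_ne_zero (f : (Fin n → ZMod 2) → ZMod 2) : ∃ a, walsh f a ≠ 0 := by
  by_contra! h
  have h1 : ∑ a, walsh f a = 2 ^ n * sgn (f 0) := by
    simp only [walsh_eq_sum_sgn, sgn_add]
    rw [Finset.sum_comm]
    simp_rw [← Finset.mul_sum, sum_sgn_dot]
    simp [mul_comm]
  simp only [h, Finset.sum_const_zero] at h1
  have h2 := sgn_mul_self (f 0)
  rcases mul_eq_zero.mp h1.symm with h3 | h3
  · exact pow_ne_zero n two_ne_zero h3
  · simp [h3] at h2

open Classical in
theorem walsh_sq {f : (Fin n → ZMod 2) → ZMod 2} (hf : degLE 2 f) (a : Fin n → ZMod 2) :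
    walsh f a ^ 2 =
      2 ^ n * ∑ u : linearSpace f, sgn (Dop (u : Fin n → ZMod 2) f 0 + ∑ i, a i * u.1 i) := by
  have h1 : walsh f a ^ 2 =
      ∑ u, sgn (∑ i, a i * u i) * ∑ x, sgn (Dop u f x) := by
    simp only [Finset.mul_sum]
    rw [Finset.sum_comm, sq, walsh_eq_sum_sgn, Finset.sum_mul]
    refine Finset.sum_congr rfl fun x _ => ?_
    rw [Finset.mul_sum, ← Equiv.sum_comp (Equiv.addLeft x)]
    refine Finset.sum_congr rfl fun u _ => ?_
    simp only [Equiv.coe_addLeft, Pi.add_apply, mul_add, Finset.sum_add_distrib, ← sgn_add, Dop]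
    congr 1
    linear_combination CharTwo.add_self_eq_zero (∑ i, a i * x i)
  have h2 : ∀ u, sgn (∑ i, a i * u i) * ∑ x, sgn (Dop u f x) =
      if u ∈ linearSpace f then 2 ^ n * sgn (Dop u f 0 + ∑ i, a i * u i) else 0 := fun u => by
    split_ifs with hu
    · rw [sum_sgn_dop_of_mem hu, sgn_add]
      ring
    · rw [sum_sgn_dop_of_notMem hf hu, mul_zero]
  rw [h1, Finset.mul_sum, Finset.sum_congr rfl fun u _ => h2 u, ← Finset.sum_filter,
    Finset.sum_subtype _ (p := (· ∈ linearSpace f)) (by simp)]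

theorem walsh_sq_eq_zero_or {f : (Fin n → ZMod 2) → ZMod 2} (hf : degLE 2 f)
    (a : Fin n → ZMod 2) :
    walsh f a = 0 ∨ walsh f a ^ 2 = 2 ^ n * (Nat.card (linearSpace f) : ℤ) := by
  classical
  let c : linearSpace f → ZMod 2 := fun u => Dop u.1 f 0 + ∑ i, a i * u.1 i
  have hc : ∀ u v, c (u + v) = c v + c u := fun u v => by
    simp only [c, AddSubgroup.coe_add, dop_add, Pi.add_apply, mul_add, Finset.sum_add_distrib,
      mem_linearSpace.mp u.2 (0 + v.1)]
    ring
  by_cases h : ∃ v, c v ≠ 0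
  · obtain ⟨v, hv⟩ := h
    left
    have : ∑ u, sgn (c u) = 0 := sum_eq_zero_of_shift_neg v fun u => by
      rw [hc, sgn_add, sgn_eq_neg_one_of_ne_zero _ hv, neg_one_mul]
    exact pow_eq_zero_iff two_ne_zero |>.mp (by rw [walsh_sq hf, this, mul_zero])
  · push Not at h
    right
    have : ∑ u, sgn (c u) = Nat.card (linearSpace f) := by
      simp [h, sgn_zero]
    rw [walsh_sq hf, this]

theorem exists_card_linearSpace_and_nl (hne : Even n) {f : (Fin n → ZMod 2) → ZMod 2}
    (hf : degLE 2 f) :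
    ∃ j : ℕ, Nat.card (linearSpace f) = 4 ^ j ∧
      nl f = 2 ^ (n - 1) - 2 ^ (n / 2 + j) / 2 := by
  obtain ⟨m, rfl⟩ := hne
  have hdvd := AddSubgroup.card_addSubgroup_dvd_card (linearSpace f)
  simp only [Nat.card_eq_fintype_card (α := Fin (m + m) → ZMod 2), Fintype.card_pi, ZMod.card,
    Finset.prod_const, Finset.card_univ, Fintype.card_fin] at hdvd
  obtain ⟨k, -, hk⟩ := (Nat.dvd_prime_pow Nat.prime_two).mp hdvd
  obtain ⟨a, ha⟩ := exists_walsh_ne_zero f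
  have hsq := (walsh_sq_eq_zero_or hf a).resolve_left ha
  have hnat : (walsh f a).natAbs ^ 2 = 2 ^ (m + m + k) := by
    zify
    rw [sq_abs, hsq, hk, pow_add]
    push_cast
    ring
  obtain ⟨i, -, hi⟩ := (Nat.dvd_prime_pow Nat.prime_two).mp
    (hnat ▸ dvd_pow_self (walsh f a).natAbs two_ne_zero)
  have hik : i * 2 = m + m + k := by
    rw [hi, ← pow_mul] at hnat
    exact Nat.pow_right_injective le_rfl hnat
  obtain ⟨j, rfl⟩ : ∃ j, k = 2 * j := ⟨i - m, by omega⟩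
  obtain rfl : i = m + j := by omega
  have habs : |walsh f a| = 2 ^ (m + j) := by
    rw [Int.abs_eq_natAbs, hi]
    push_cast
    rfl
  refine ⟨j, by rw [hk, pow_mul]; norm_num, ?_⟩
  have hsup : (Finset.univ.sup' Finset.univ_nonempty fun a => |walsh f a|) = 2 ^ (m + j) := by
    refine le_antisymm (Finset.sup'_le _ _ fun b _ => ?_)
      (habs ▸ Finset.le_sup' (fun a => |walsh f a|) (Finset.mem_univ a))
    rcases walsh_sq_eq_zero_or hf b with hb | hb
    · simp [hb]
    · exact ((sq_eq_sq_iff_abs_eq_abs _ _).mp (hb.trans hsq.symm)).trans habs |>.le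
  rw [nl, hsup, show (m + m) / 2 = m by omega]

end Boolean

section Vectorial

variable {n : ℕ} {Q : (Fin n → ZMod 2) → (Fin n → ZMod 2)}

theorem linearSpace_comp_zero : linearSpace (comp 0 Q) = ⊤ := by
  rw [AddSubgroup.eq_top_iff']
  intro u x
  simp [Dop, comp]

theorem dop_comp (a lam x : Fin n → ZMod 2) :
    Dop a (comp lam Q) x = ∑ i, lam i * (Q (x + a) + Q x) i := by
  simp [Dop, comp, mul_add, Finset.sum_add_distrib]

theorem IsAPN.card_fiber (hapn : IsAPN Q) {a : Fin n → ZMod 2} (ha : a ≠ 0)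
    (x : Fin n → ZMod 2) :
    (Finset.univ.filter fun y => Q (y + a) + Q y = Q (x + a) + Q x).card = 2 := by
  refine le_antisymm (hapn a ha _) ?_
  have hx : x ≠ x + a := by simpa using ha
  refine (Finset.card_pair hx).symm.le.trans ?_
  refine Finset.card_le_card fun y hy => ?_
  rw [Finset.mem_insert, Finset.mem_singleton] at hy
  rcases hy with rfl | rfl
  · simp
  · simp [add_assoc, add_self_zmod_two_pi, add_comm (Q x)]

open Classical in
theorem IsAPN.card_mem_linearSpace (hapn : IsAPN Q) (hQ : ∀ lam, degLE 2 (comp lam Q))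
    {a : Fin n → ZMod 2} (ha : a ≠ 0) :
    (Finset.univ.filter fun lam => a ∈ linearSpace (comp lam Q)).card = 2 := by
  have h1 : ∑ lam, (∑ x, sgn (Dop a (comp lam Q) x)) ^ 2 =
      (2 ^ n * 2 ^ n) * ((Finset.univ.filter fun lam => a ∈ linearSpace (comp lam Q)).card : ℤ) := by
    rw [Finset.card_filter, Nat.cast_sum, Finset.mul_sum]
    refine Finset.sum_congr rfl fun lam _ => ?_
    split_ifs with h
    · rw [sum_sgn_dop_of_mem h]
      linear_combination 2 ^ n * 2 ^ n * sgn_mul_self (Dop a (comp lam Q) 0)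
    · simp [sum_sgn_dop_of_notMem (hQ lam) h]
  have h2 : ∑ lam, (∑ x, sgn (Dop a (comp lam Q) x)) ^ 2 = (2 ^ n * 2 ^ n) * 2 := by
    have hexp : ∀ lam, (∑ x, sgn (Dop a (comp lam Q) x)) ^ 2 =
        ∑ x, ∑ y, sgn (∑ i, lam i * ((Q (y + a) + Q y) + (Q (x + a) + Q x)) i) := fun lam => by
      rw [sq, Finset.sum_mul_sum, Finset.sum_comm]
      refine Finset.sum_congr rfl fun x _ => Finset.sum_congr rfl fun y _ => ?_
      rw [← sgn_add, dop_comp, dop_comp, ← Finset.sum_add_distrib]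
      simp only [← mul_add, ← Pi.add_apply]
    have hin : ∀ x, ∑ lam : Fin n → ZMod 2, ∑ y,
        sgn (∑ i, lam i * ((Q (y + a) + Q y) + (Q (x + a) + Q x)) i) =
        2 ^ n * 2 := fun x => by
      have hz : ∀ v w : Fin n → ZMod 2, v + w = 0 ↔ v = w := fun v w => by
        rw [add_eq_zero_iff_eq_neg, neg_eq_of_add_eq_zero_left (add_self_zmod_two_pi w)]
      rw [Finset.sum_comm]
      simp only [sum_sgn_dot, hz]
      rw [← Finset.sum_filter, Finset.sum_const, hapn.card_fiber ha x]
      simp [mul_comm]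
    rw [Finset.sum_congr rfl fun lam _ => hexp lam, Finset.sum_comm,
      Finset.sum_congr rfl fun x _ => hin x]
    simp [mul_assoc]
  have h3 := mul_left_cancel₀ (by positivity) (h1.symm.trans h2)
  exact_mod_cast h3

theorem IsAPN.sum_card_linearSpace (hapn : IsAPN Q) (hQ : ∀ lam, degLE 2 (comp lam Q)) :
    ∑ lam ∈ Finset.univ.filter (fun lam : Fin n → ZMod 2 => lam ≠ 0),
      (Nat.card (linearSpace (comp lam Q)) : ℤ) = 2 * (2 ^ n - 1) := by
  classical
  have hall : ∑ lam, (Nat.card (linearSpace (comp lam Q)) : ℤ) = 2 ^ n + 2 * (2 ^ n - 1) := by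
    have h1 : ∀ lam, (Nat.card (linearSpace (comp lam Q)) : ℤ) =
        ∑ a, if a ∈ linearSpace (comp lam Q) then 1 else 0 := fun lam => by
      rw [Finset.sum_boole, Nat.card_eq_fintype_card]
      exact_mod_cast Fintype.card_subtype _
    rw [Finset.sum_congr rfl fun lam _ => h1 lam, Finset.sum_comm,
      ← Finset.add_sum_erase _ _ (Finset.mem_univ 0)]
    congr 1
    · simp [zero_mem]
    · rw [Finset.sum_congr rfl fun a ha => by
        rw [Finset.sum_boole, hapn.card_mem_linearSpace hQ (Finset.ne_of_mem_erase ha)]]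
      simp [Finset.card_erase_of_mem, mul_comm]
  rw [← Finset.add_sum_erase _ _ (Finset.mem_univ 0), linearSpace_comp_zero] at hall
  have htop : (Nat.card (⊤ : AddSubgroup (Fin n → ZMod 2)) : ℤ) = 2 ^ n := by simp
  rw [Finset.filter_ne']
  linarith

theorem nlV_eq_of_card_linearSpace (hne : Even n) (hn : 0 < n)
    (hQ : ∀ lam, degLE 2 (comp lam Q)) (J : ℕ)
    (hle : ∀ lam, lam ≠ 0 → Nat.card (linearSpace (comp lam Q)) ≤ 4 ^ J)
    (hex : ∃ lam, lam ≠ 0 ∧ Nat.card (linearSpace (comp lam Q)) = 4 ^ J) :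
    nlV hn Q = 2 ^ (n - 1) - 2 ^ (n / 2 + J) / 2 := by
  refine le_antisymm ?_ (Finset.le_inf' _ _ fun lam hlam => ?_)
  · obtain ⟨lam, h0, hcard⟩ := hex
    obtain ⟨j, hj, hnl⟩ := exists_card_linearSpace_and_nl hne (hQ lam)
    obtain rfl : j = J := Nat.pow_right_injective (by norm_num : 2 ≤ 4) (hj.symm.trans hcard)
    exact (Finset.inf'_le _ (by simpa using h0)).trans hnl.le
  · obtain ⟨j, hj, hnl⟩ := exists_card_linearSpace_and_nl hne (hQ lam)
    have hjJ : j ≤ J := (Nat.pow_le_pow_iff_right (by norm_num : 1 < 4)).mp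
      (hj ▸ hle lam (by simpa using hlam))
    rw [hnl]
    have : (2 : ℤ) ^ (n / 2 + j) ≤ 2 ^ (n / 2 + J) :=
      pow_le_pow_right₀ (by norm_num) (by omega)
    have := Int.ediv_le_ediv (by norm_num : (0 : ℤ) < 2) this
    linarith

open Classical in
theorem IsAPN.sum_nonbent_card_sub_four (hapn : IsAPN Q) (hQ : ∀ lam, degLE 2 (comp lam Q)) :
    ∑ lam ∈ (Finset.univ.filter fun lam : Fin n → ZMod 2 => lam ≠ 0).filter
        (fun lam => linearSpace (comp lam Q) ≠ ⊥),
      ((Nat.card (linearSpace (comp lam Q)) : ℤ) - 4) =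
    3 * ({lam : Fin n → ZMod 2 | lam ≠ 0 ∧ linearSpace (comp lam Q) = ⊥}.ncard : ℤ) -
      2 * (2 ^ n - 1) := by
  have hcard : ((Finset.univ.filter fun lam : Fin n → ZMod 2 => lam ≠ 0).card : ℤ) = 2 ^ n - 1 := by
    rw [Finset.filter_ne', Finset.card_erase_of_mem (Finset.mem_univ 0),
      Nat.cast_sub (by simp [Nat.one_le_two_pow])]
    simp
  have hsum : ∑ lam ∈ Finset.univ.filter (fun lam : Fin n → ZMod 2 => lam ≠ 0),
      ((Nat.card (linearSpace (comp lam Q)) : ℤ) - 4) = -2 * (2 ^ n - 1) := by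
    rw [Finset.sum_sub_distrib, hapn.sum_card_linearSpace hQ, Finset.sum_const, nsmul_eq_mul, hcard]
    ring
  rw [← Finset.sum_filter_add_sum_filter_not _ (fun lam => linearSpace (comp lam Q) ≠ ⊥)] at hsum
  have hbent : ∑ lam ∈ (Finset.univ.filter fun lam : Fin n → ZMod 2 => lam ≠ 0).filter
        (fun lam => ¬ linearSpace (comp lam Q) ≠ ⊥),
      ((Nat.card (linearSpace (comp lam Q)) : ℤ) - 4) =
    -3 * ({lam : Fin n → ZMod 2 | lam ≠ 0 ∧ linearSpace (comp lam Q) = ⊥}.ncard : ℤ) := by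
    have h1 : ∀ lam ∈ (Finset.univ.filter fun lam : Fin n → ZMod 2 => lam ≠ 0).filter
        (fun lam => ¬ linearSpace (comp lam Q) ≠ ⊥),
        ((Nat.card (linearSpace (comp lam Q)) : ℤ) - 4) = -3 := fun lam hlam => by
      rw [not_ne_iff.mp (Finset.mem_filter.mp hlam).2]
      simp
    rw [Finset.sum_congr rfl h1, Finset.sum_const, Finset.filter_filter, nsmul_eq_mul, mul_comm,
      Set.ncard_eq_toFinset_card', Set.toFinset_ofPred]
    simp only [not_ne_iff]
  linarith

theorem card_linearSpace_eq_or (hne : Even n) (hQ : ∀ lam, degLE 2 (comp lam Q))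
    (lam : Fin n → ZMod 2) :
    linearSpace (comp lam Q) = ⊥ ∨ Nat.card (linearSpace (comp lam Q)) = 4 ∨
      Nat.card (linearSpace (comp lam Q)) = 16 ∨ 64 ≤ Nat.card (linearSpace (comp lam Q)) := by
  obtain ⟨j, hj, -⟩ := exists_card_linearSpace_and_nl hne (hQ lam)
  match j, hj with
  | 0, hj => exact .inl (AddSubgroup.card_eq_one.mp hj)
  | 1, hj => exact .inr (.inl hj)
  | 2, hj => exact .inr (.inr (.inl hj))
  | j + 3, hj =>
    refine .inr (.inr (.inr ?_))
    rw [hj, pow_add]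
    have := Nat.one_le_pow j 4 (by norm_num)
    omega

theorem IsAPN.card_linearSpace_sub_four_le (hapn : IsAPN Q) (hne : Even n)
    (hQ : ∀ lam, degLE 2 (comp lam Q)) {lam : Fin n → ZMod 2} (h0 : lam ≠ 0)
    (hbot : linearSpace (comp lam Q) ≠ ⊥) :
    (Nat.card (linearSpace (comp lam Q)) : ℤ) - 4 ≤
      3 * ({lam : Fin n → ZMod 2 | lam ≠ 0 ∧ linearSpace (comp lam Q) = ⊥}.ncard : ℤ) -
        2 * (2 ^ n - 1) := by
  classical
  rw [← hapn.sum_nonbent_card_sub_four hQ]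
  refine Finset.single_le_sum (f := fun lam => (Nat.card (linearSpace (comp lam Q)) : ℤ) - 4)
    (fun mu hmu => ?_) (by simp [h0, hbot])
  have := (card_linearSpace_eq_or hne hQ mu).resolve_left (Finset.mem_filter.mp hmu).2
  omega

end Vectorial

theorem stmt_17 (n : ℕ) (hne : Even n)
    (Q : (Fin n → ZMod 2) → (Fin n → ZMod 2))
    (hquad : ∀ lam : Fin n → ZMod 2, lam ≠ 0 →
      degLE 2 (comp lam Q) ∧ ¬ degLE 1 (comp lam Q))
    (hapn : IsAPN Q) :
    ∀ B : ℕ, B = {lam : Fin n → ZMod 2 | lam ≠ 0 ∧ IsBent (comp lam Q)}.ncard →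
      (∀ _ : 4 ≤ n, B = 2 * (2 ^ n - 1) / 3 →
        nlV (by omega) Q = 2 ^ (n - 1) - 2 ^ (n / 2)) ∧
      (∀ _ : 6 ≤ n, ∀ t : ℕ, 1 ≤ t → t ≤ 4 → B = 2 * (2 ^ n - 1) / 3 + 4 * t →
        nlV (by omega) Q = 2 ^ (n - 1) - 2 ^ (n / 2 + 1)) := by
  classical
  intro B hB
  have hQ : ∀ lam, degLE 2 (comp lam Q) := fun lam => by
    by_cases h : lam = 0
    · subst h
      rintro (_ | ⟨a, l⟩) hl
      · simp at hl
      · have hz : ∀ l : List (Fin n → ZMod 2), l.foldr Dop (comp 0 Q) = fun _ => 0 := fun l => by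
          induction l with
          | nil => simp [funext_iff, comp]
          | cons a l ih => simp [ih, Dop, funext_iff]
        exact hz _
    · exact (hquad lam h).1
  have hbound := fun lam h0 hbot =>
    hapn.card_linearSpace_sub_four_le hne hQ (lam := lam) h0 hbot
  have hsum := hapn.sum_nonbent_card_sub_four hQ
  have hpow : 2 ^ n % 3 = 1 := by
    obtain ⟨m, rfl⟩ := hne
    rw [← two_mul, pow_mul, Nat.pow_mod]
    norm_num
  have hpos : 1 ≤ 2 ^ n := Nat.one_le_two_pow
  have hcast : ((2 : ℤ) ^ n) = ((2 ^ n : ℕ) : ℤ) := by push_cast; rfl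
  have hset (hn : 0 < n) : {lam : Fin n → ZMod 2 | lam ≠ 0 ∧ linearSpace (comp lam Q) = ⊥} =
      {lam : Fin n → ZMod 2 | lam ≠ 0 ∧ IsBent (comp lam Q)} := by
    simp only [isBent_iff_linearSpace_eq_bot hn (hQ _)]
  have hor := card_linearSpace_eq_or hne hQ
  have hbot : ∀ lam, linearSpace (comp lam Q) = ⊥ → Nat.card (linearSpace (comp lam Q)) = 1 :=
    fun lam h => by rw [h]; simp
  refine ⟨fun hn hBn => ?_, fun hn t ht1 ht4 hBn => ?_⟩
  · have hn0 : 0 < n := by omega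
    rw [hset hn0, ← hB] at hbound hsum
    rw [nlV_eq_of_card_linearSpace hne hn0 hQ 1, pow_succ, Int.mul_ediv_cancel _ two_ne_zero]
    · intro lam h0
      rcases hor lam with h | h
      · rw [hbot lam h]; norm_num
      · have := hbound lam h0 (fun hb => by have := hbot lam hb; omega)
        omega
    · by_contra! hcon
      have hall : ∀ lam, lam ≠ 0 → linearSpace (comp lam Q) = ⊥ := fun lam h0 => by
        by_contra hb
        have := hbound lam h0 hb
        have := (hor lam).resolve_left hb
        have := hcon lam h0
        omega
      have hfull := hapn.sum_card_linearSpace hQ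
      rw [Finset.sum_congr rfl fun lam hlam => by
        rw [hbot lam (hall lam (Finset.mem_filter.mp hlam).2)], Finset.filter_ne'] at hfull
      have : 1 < 2 ^ n := Nat.one_lt_two_pow (by omega)
      simp [Finset.card_erase_of_mem] at hfull
      omega
  · have hn0 : 0 < n := by omega
    rw [hset hn0, ← hB] at hbound hsum
    rw [nlV_eq_of_card_linearSpace hne hn0 hQ 2, pow_succ _ (n / 2 + 1),
      Int.mul_ediv_cancel _ two_ne_zero]
    · intro lam h0
      rcases hor lam with h | h
      · rw [hbot lam h]; norm_num
      · have := hbound lam h0 (fun hb => by have := hbot lam hb; omega)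
        omega
    · by_contra! hcon
      rw [Finset.sum_eq_zero fun lam hlam => ?_] at hsum
      · omega
      · obtain ⟨hlam, hb⟩ := Finset.mem_filter.mp hlam
        have h0 := (Finset.mem_filter.mp hlam).2
        have := hbound lam h0 hb
        have := (hor lam).resolve_left hb
        have := hcon lam h0
        omega
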